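/- Let R be a commutative ring in which q(q²−1) is invertible and let r ≥ 0. In the group algebra R[G_{r+4}] set e = e_{r+4,r}, T = q²·e·σ·e with σ the permutation matrix of (1,2)(r+3,r+4), X = (−q)^r·e·τ·e with τ the permutation matrix of (2,r+3), and X' = (−q)^{r+2}·e·ρ·e with ρ the permutation matrix of (1,r+4). Then T·X·T = q²·X'. -/

import Mathlib

open scoped MatrixGroups Matrix

noncomputable section

variable (F : Type*) [Field F]

/-- The anti-diagonal matrix `J` with entries 1 at positions `(i, n-1-i)`. -/
def Jmat (n : ℕ) : Matrix (Fin n) (Fin n) F :=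
  Matrix.of fun i j => if j = Fin.rev i then 1 else 0

lemma Jmat_mul_self (n : ℕ) : Jmat F n * Jmat F n = 1 := by
  ext i j
  rw [Matrix.mul_apply]
  simp only [Jmat, Matrix.of_apply, Matrix.one_apply]
  rw [Finset.sum_eq_single (Fin.rev i)]
  · simp [Fin.rev_rev, eq_comm]
  · intro k _ hk
    rw [if_neg hk, zero_mul]
  · exact fun h => absurd (Finset.mem_univ _) h

/-- `J` as an element of the general linear group. -/
def Junit (n : ℕ) : GL (Fin n) F :=
  ⟨Jmat F n, Jmat F n, Jmat_mul_self F n, Jmat_mul_self F n⟩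

/-- The group automorphism `g ↦ ᵗg⁻¹` of `GL_n`. -/
def transposeInvHom (n : ℕ) : GL (Fin n) F →* GL (Fin n) F where
  toFun g := ⟨(g⁻¹).valᵀ, g.valᵀ,
    by rw [← Matrix.transpose_mul, ← Units.val_mul, mul_inv_cancel, Units.val_one,
      Matrix.transpose_one],
    by rw [← Matrix.transpose_mul, ← Units.val_mul, inv_mul_cancel, Units.val_one,
      Matrix.transpose_one]⟩
  map_one' := by
    apply Units.ext
    show ((1 : GL (Fin n) F)⁻¹).valᵀ = _
    simp
  map_mul' g h := by
    apply Units.ext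
    show ((g * h)⁻¹).valᵀ = (g⁻¹).valᵀ * (h⁻¹).valᵀ
    rw [mul_inv_rev, Units.val_mul, Matrix.transpose_mul]

/-- The twisted Frobenius endomorphism `g ↦ J · ᵗ(φ(g))⁻¹ · J` of `GL_n(F)`,
where `φ` is the `q`-power Frobenius. -/
def twistedFrobenius (φ : F →+* F) (n : ℕ) : GL (Fin n) F →* GL (Fin n) F :=
  (MulAut.conj (Junit F n)).toMonoidHom.comp
    ((transposeInvHom F n).comp (Matrix.GeneralLinearGroup.map φ))

/-- The finite unitary group `GU_n(q)`, as the subgroup of `GL_n(𝔽_{q²})` of fixed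
points of the twisted Frobenius, i.e. `g = J · ᵗ(g^{(q)})⁻¹ · J`. -/
def GU (φ : F →+* F) (n : ℕ) : Subgroup (GL (Fin n) F) where
  carrier := {g | twistedFrobenius F φ n g = g}
  one_mem' := by simp
  mul_mem' := by
    intro a b ha hb
    simp only [Set.mem_setOf_eq] at *
    rw [map_mul, ha, hb]
  inv_mem' := by
    intro a ha
    simp only [Set.mem_setOf_eq] at *
    rw [map_inv, ha]

/-- The permutation matrix of a permutation `w`. -/
def permMat (n : ℕ) (w : Equiv.Perm (Fin n)) : Matrix (Fin n) (Fin n) F :=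
  Matrix.of fun i j => if w i = j then 1 else 0

/-- The set of matrices underlying the subgroup `U_r ≤ G_{r+2}`: upper triangular
matrices whose middle `r × r` block is the identity. -/
def UrSet (r : ℕ) : Set (Matrix (Fin (r + 2)) (Fin (r + 2)) F) :=
  {g | (∀ i j : Fin (r + 2), (j : ℕ) < (i : ℕ) → g i j = 0) ∧
       (∀ i : Fin (r + 2), 1 ≤ (i : ℕ) → (i : ℕ) ≤ r → g i i = 1) ∧
       (∀ i j : Fin (r + 2), 1 ≤ (i : ℕ) → (i : ℕ) < (j : ℕ) → (j : ℕ) ≤ r → g i j = 0)}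

/-- Entries of the `o`-fold middle-block (centered) embedding of a matrix. -/
def cembFun {a : ℕ} (o : ℕ) (u : Matrix (Fin a) (Fin a) F) (p q : ℕ) : F :=
  if h : o ≤ p ∧ p < o + a ∧ o ≤ q ∧ q < o + a then
    u ⟨p - o, by omega⟩ ⟨q - o, by omega⟩
  else if p = q then 1 else 0

/-- The subgroup `U_{n,r} ≤ G_n` (for `n = r + 2m`), generated by `U_{n-2}` together with
the images of `U_{n-4}, …, U_r` under the iterated middle-block embeddings. -/
def Unr (φ : F →+* F) (r m : ℕ) : Subgroup (GU F φ (r + 2 * m)) :=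
  Subgroup.closure
    {g | ∃ k : ℕ, k < m ∧
      ∃ u : Matrix (Fin (r + 2 * k + 2)) (Fin (r + 2 * k + 2)) F,
        u ∈ UrSet F (r + 2 * k) ∧
        ∀ p q : Fin (r + 2 * m),
          ((g : GL (Fin (r + 2 * m)) F) : Matrix (Fin (r + 2 * m)) (Fin (r + 2 * m)) F) p q
            = cembFun F (m - 1 - k) u (p : ℕ) (q : ℕ)}

/-- The idempotent `e_S = |S|⁻¹ ∑_{g ∈ S} g` in the group algebra `R[G]`. -/
def eSub (R : Type*) [CommRing R] {G : Type*} [Group G] (S : Subgroup G) :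
    MonoidAlgebra R G :=
  Ring.inverse ((Nat.card S : R)) • ∑ᶠ g : S, MonoidAlgebra.of R G (g : G)

end

section GroupAlgebra

variable {R : Type*} [CommRing R] {G : Type*} [Group G] [Finite G]

lemma of_mul_eSub (S : Subgroup G) {g : G} (hg : g ∈ S) :
    MonoidAlgebra.of R G g * eSub R S = eSub R S := by
  have := Fintype.ofFinite S
  rw [eSub, finsum_eq_sum_of_fintype, mul_smul_comm, Finset.mul_sum]
  congr 1
  simp_rw [← map_mul]
  exact Fintype.sum_equiv (Equiv.mulLeft (⟨g, hg⟩ : S)) _ _ fun _ => rfl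

lemma eSub_mul_of (S : Subgroup G) {g : G} (hg : g ∈ S) :
    eSub R S * MonoidAlgebra.of R G g = eSub R S := by
  have := Fintype.ofFinite S
  rw [eSub, finsum_eq_sum_of_fintype, smul_mul_assoc, Finset.sum_mul]
  congr 1
  simp_rw [← map_mul]
  exact Fintype.sum_equiv (Equiv.mulRight (⟨g, hg⟩ : S)) _ _ fun _ => rfl

/-- If all products `a * u * b` with `u ∈ S` take a common value `c`, then `a * e_S * b = c`. -/
lemma mul_eSub_mul_eq {S : Subgroup G} (hS : IsUnit (Nat.card S : R)) {a b c : MonoidAlgebra R G}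
    (h : ∀ u ∈ S, a * MonoidAlgebra.of R G u * b = c) : a * eSub R S * b = c := by
  have := Fintype.ofFinite S
  rw [eSub, finsum_eq_sum_of_fintype, mul_smul_comm, smul_mul_assoc, Finset.mul_sum,
    Finset.sum_mul, Finset.sum_congr rfl fun (u : S) _ => h u u.2, Finset.sum_const,
    Finset.card_univ, ← Nat.card_eq_fintype_card, ← Nat.cast_smul_eq_nsmul R, smul_smul,
    Ring.inverse_mul_cancel _ hS, one_smul]

lemma eSub_mul_self {S : Subgroup G} (hS : IsUnit (Nat.card S : R)) :
    eSub R S * eSub R S = eSub R S := by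
  have := mul_eSub_mul_eq (a := 1) (b := eSub R S) (c := eSub R S) hS
    fun u hu => by rw [one_mul, of_mul_eSub S hu]
  rwa [one_mul] at this

/-- Length-additive multiplication: if every element of `S` factors as `a * b` where `x` carries
`a` into `S` from the left and `y` carries `b` into `S` from the right, then
`e x e y e = e (x y) e`. -/
lemma eSub_mul_of_mul_eSub_mul_of_mul_eSub {S : Subgroup G} (hS : IsUnit (Nat.card S : R))
    {x y : G} (h : ∀ u ∈ S, ∃ a b, u = a * b ∧ x * a * x⁻¹ ∈ S ∧ y⁻¹ * b * y ∈ S) :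
    eSub R S * MonoidAlgebra.of R G x * eSub R S * (MonoidAlgebra.of R G y * eSub R S) =
      eSub R S * MonoidAlgebra.of R G (x * y) * eSub R S := by
  refine mul_eSub_mul_eq hS fun u hu => ?_
  obtain ⟨a, b, rfl, ha, hb⟩ := h u hu
  have hl : eSub R S * MonoidAlgebra.of R G (x * a) = eSub R S * MonoidAlgebra.of R G x := by
    rw [← inv_mul_cancel_right (x * a) x, map_mul, ← mul_assoc, eSub_mul_of S ha]
  have hr : MonoidAlgebra.of R G (b * y) * eSub R S = MonoidAlgebra.of R G y * eSub R S := by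
    rw [← mul_inv_cancel_left y (b * y), ← mul_assoc y⁻¹, map_mul, mul_assoc, of_mul_eSub S hb]
  calc _ = eSub R S * MonoidAlgebra.of R G (x * a) * (MonoidAlgebra.of R G (b * y) * eSub R S) := by
        simp only [map_mul, mul_assoc]
    _ = _ := by rw [hl, hr, map_mul]; simp only [mul_assoc]

/-- The braid-type identity `(e x e) (e y e) (e x e) = e (x y x) e`. -/
lemma eSub_braid {S : Subgroup G} (hS : IsUnit (Nat.card S : R)) {x y : G}
    (h₁ : ∀ u ∈ S, ∃ a b, u = a * b ∧ x * a * x⁻¹ ∈ S ∧ y⁻¹ * b * y ∈ S)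
    (h₂ : ∀ u ∈ S, ∃ a b, u = a * b ∧ (x * y) * a * (x * y)⁻¹ ∈ S ∧ x⁻¹ * b * x ∈ S) :
    (eSub R S * MonoidAlgebra.of R G x * eSub R S) *
      (eSub R S * MonoidAlgebra.of R G y * eSub R S) *
      (eSub R S * MonoidAlgebra.of R G x * eSub R S) =
      eSub R S * MonoidAlgebra.of R G (x * y * x) * eSub R S := by
  have e := eSub_mul_self hS
  have k₁ := eSub_mul_of_mul_eSub_mul_of_mul_eSub hS h₁
  have k₂ := eSub_mul_of_mul_eSub_mul_of_mul_eSub hS h₂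
  rw [← k₂, ← k₁]
  have e' (z : MonoidAlgebra R G) : eSub R S * (eSub R S * z) = eSub R S * z := by
    rw [← mul_assoc, e]
  simp only [mul_assoc, e']

end GroupAlgebra

section Unitary

variable {F : Type*} [Field F] {φ : F →+* F} {n : ℕ}

/-- The matrix `J · ᵗφ(M) · J`, inverse to `M` exactly when `M` is unitary. -/
def twistStar (φ : F →+* F) {n : ℕ} (M : Matrix (Fin n) (Fin n) F) : Matrix (Fin n) (Fin n) F :=
  Matrix.of fun i j => φ (M j.rev i.rev)

lemma Jmat_mul_mul_Jmat (M : Matrix (Fin n) (Fin n) F) (i j : Fin n) :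
    (Jmat F n * M * Jmat F n) i j = M i.rev j.rev := by
  have h (k : Fin n) : j = k.rev ↔ k = j.rev := by rw [← Fin.rev_eq_iff, eq_comm]
  simp [Matrix.mul_apply, Jmat, h]

lemma twistedFrobenius_inv_val (g : GL (Fin n) F) :
    ((twistedFrobenius F φ n g)⁻¹).val = twistStar φ g.val := by
  have : ((twistedFrobenius F φ n g)⁻¹).val = Jmat F n * (g.val.map φ)ᵀ * Jmat F n := by
    rw [mul_assoc]; rfl
  rw [this]
  ext i j
  rw [Jmat_mul_mul_Jmat]
  rfl

lemma mem_GU_iff {g : GL (Fin n) F} : g ∈ GU F φ n ↔ g.val * twistStar φ g.val = 1 := by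
  rw [← twistedFrobenius_inv_val, ← Units.val_mul, Units.val_eq_one, mul_inv_eq_one, eq_comm]
  rfl

/-- The unitary group element underlying a matrix inverted by `twistStar`. -/
def GU.ofMatrix (M : Matrix (Fin n) (Fin n) F) (h : M * twistStar φ M = 1) : GU F φ n :=
  ⟨⟨M, twistStar φ M, h, mul_eq_one_comm.1 h⟩, mem_GU_iff.2 h⟩

/-- The matrix of an element of the unitary group. -/
def guMat (g : GU F φ n) : Matrix (Fin n) (Fin n) F := g.1.val

lemma guMat_injective : Function.Injective (guMat : GU F φ n → _) :=
  fun _ _ h => Subtype.ext (Units.ext h)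

lemma guMat_mul (g h : GU F φ n) : guMat (g * h) = guMat g * guMat h := rfl

lemma guMat_one : guMat (1 : GU F φ n) = 1 := rfl

lemma guMat_pow (g : GU F φ n) (m : ℕ) : guMat (g ^ m) = guMat g ^ m := by
  simp [guMat]

lemma guMat_ofMatrix (M : Matrix (Fin n) (Fin n) F) (h : M * twistStar φ M = 1) :
    guMat (GU.ofMatrix M h) = M := rfl

lemma guMat_inv (g : GU F φ n) : guMat g⁻¹ = twistStar φ (guMat g) := by
  rw [← mul_one (guMat g⁻¹), ← mem_GU_iff.1 g.2, ← mul_assoc]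
  change guMat g⁻¹ * guMat g * _ = _
  rw [← guMat_mul, inv_mul_cancel, guMat_one, one_mul]
  rfl

lemma GU.sum_mul_eq (g : GU F φ n) (i j : Fin n) :
    ∑ k, guMat g i k * φ (guMat g j.rev k.rev) = if i = j then 1 else 0 := by
  rw [← Matrix.one_apply, ← mem_GU_iff.1 g.2]
  rfl

lemma GU.mul_apply (g h : GU F φ n) (i j : Fin n) :
    guMat (g * h) i j = ∑ k, guMat g i k * guMat h k j := rfl

lemma GU.inv_apply (g : GU F φ n) (i j : Fin n) : guMat g⁻¹ i j = φ (guMat g j.rev i.rev) := by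
  rw [guMat_inv]; rfl

/-- Conjugating by a permutation matrix permutes the indices. -/
lemma GU.conj_apply {s g : GU F φ n} {w : Equiv.Perm (Fin n)} (hs : guMat s = permMat F n w)
    (i j : Fin n) : guMat (s * g * s⁻¹) i j = guMat g (w i) (w j) := by
  have h : guMat (s * g * s⁻¹) * guMat s = guMat s * guMat g := by
    rw [← guMat_mul, inv_mul_cancel_right, guMat_mul]
  have h' := congrFun (congrFun h i) (w j)
  rw [hs, Matrix.mul_apply, Matrix.mul_apply] at h'
  simpa [permMat] using h'

end Unitary

section Card

variable {F : Type*} [Field F]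

lemma isUnit_natCast_of_forall_prime {R : Type*} [CommRing R] {n : ℕ} (hn : n ≠ 0)
    (h : ∀ l : ℕ, l.Prime → l ∣ n → IsUnit (l : R)) : IsUnit (n : R) := by
  induction n using induction_on_primes with
  | zero => exact absurd rfl hn
  | one => simp
  | prime_mul l a hl ih =>
    rw [Nat.cast_mul]
    exact (h l hl (dvd_mul_right _ _)).mul
      (ih (right_ne_zero_of_mul hn) fun l' hl' hd => h l' hl' (hd.mul_left _))

/-- An invertible upper triangular matrix over a finite field of characteristic `p` has order
dividing `(|F| - 1) * p ^ n`. -/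
lemma pow_eq_one_of_upperTriangular [Fintype F] {n p : ℕ} [Fact p.Prime] [CharP F p]
    {M : Matrix (Fin n) (Fin n) F} (hM : M.BlockTriangular id) (hdet : M.det ≠ 0) :
    M ^ ((Fintype.card F - 1) * p ^ n) = 1 := by
  have hdiag (i : Fin n) : M i i ≠ 0 := by
    rw [Matrix.det_of_isUpperTriangular hM, Finset.prod_ne_zero_iff] at hdet
    exact hdet i (Finset.mem_univ i)
  have hdvd : M.charpoly ∣ (Polynomial.X ^ (Fintype.card F - 1) - 1) ^ n := by
    rw [Matrix.charpoly_of_isUpperTriangular M hM]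
    have := Finset.prod_dvd_prod_of_dvd (s := (Finset.univ : Finset (Fin n)))
      (fun i => Polynomial.X - Polynomial.C (M i i))
      (fun _ => Polynomial.X ^ (Fintype.card F - 1) - 1) fun i _ => by
        rw [Polynomial.dvd_iff_isRoot]
        simp [FiniteField.pow_card_sub_one_eq_one _ (hdiag i)]
    simpa using this
  have hnil : (M ^ (Fintype.card F - 1) - 1) ^ n = 0 := by
    obtain ⟨c, hc⟩ := hdvd
    have := congrArg (Polynomial.aeval M) hc
    simpa [Matrix.aeval_self_charpoly] using this
  have hz : (M ^ (Fintype.card F - 1) - 1) ^ p ^ n = 0 :=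
    pow_eq_zero_of_le (Nat.lt_pow_self (Fact.out : p.Prime).one_lt).le hnil
  rcases isEmpty_or_nonempty (Fin n) with h | h
  · exact Subsingleton.elim _ _
  · have : CharP (Matrix (Fin n) (Fin n) F) p := inferInstance
    rw [sub_pow_char_pow_of_commute _ _ (Commute.one_right _), one_pow, sub_eq_zero, ← pow_mul] at hz
    exact hz

lemma isUnit_card_of_upperTriangular [Fintype F] {R : Type*} [CommRing R] {p k q n : ℕ}
    (hp : p.Prime) (hk : 0 < k) (hq : q = p ^ k) (hcard : Fintype.card F = q ^ 2)
    {φ : F →+* F} (hR : IsUnit ((q : R) * ((q : R) ^ 2 - 1))) {S : Subgroup (GU F φ n)}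
    (hS : ∀ g ∈ S, (guMat g).BlockTriangular id) : IsUnit (Nat.card S : R) := by
  classical
  have := Fact.mk hp
  have : CharP F p := charP_of_card_eq_prime_pow (f := k * 2) (by
    rw [hcard, hq, pow_mul])
  refine isUnit_natCast_of_forall_prime Nat.card_pos.ne' fun l hl hd => ?_
  have := Fact.mk hl
  obtain ⟨g, hg⟩ := exists_prime_orderOf_dvd_card' l hd
  have hpow : g ^ ((Fintype.card F - 1) * p ^ n) = 1 := by
    apply Subtype.ext
    apply guMat_injective
    rw [Subgroup.coe_pow, guMat_pow]
    refine pow_eq_one_of_upperTriangular (hS g g.2) ?_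
    exact ((Matrix.isUnit_iff_isUnit_det _).1 g.1.1.isUnit).ne_zero
  have hq1 : 1 ≤ q ^ 2 := by rw [← hcard]; exact Fintype.card_pos
  rw [← orderOf_dvd_iff_pow_eq_one, hg, hl.dvd_mul, hcard] at hpow
  refine isUnit_of_dvd_unit ?_ hR
  rcases hpow with h | h
  · refine Dvd.dvd.mul_left ?_ _
    simpa [Nat.cast_sub hq1] using Nat.cast_dvd_cast (α := R) h
  · refine Dvd.dvd.mul_right (Nat.cast_dvd_cast ?_) _
    rw [hq]
    exact (hl.dvd_of_dvd_pow h).trans (dvd_pow_self p hk.ne')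

end Card

section Parabolic

variable {F : Type*} [Field F] {n : ℕ}

/-- The upper triangular unitary matrices whose middle block, obtained by dropping `a` indices at
each end, is the identity. -/
def midUnipotent (φ : F →+* F) (a n : ℕ) : Subgroup (GU F φ n) where
  carrier := {g | (guMat g).BlockTriangular id ∧ ∀ i j : Fin n, a ≤ (i : ℕ) → (i : ℕ) + a < n →
    a ≤ (j : ℕ) → (j : ℕ) + a < n → guMat g i j = if i = j then 1 else 0}
  one_mem' := ⟨by rw [guMat_one]; exact Matrix.blockTriangular_one,
    fun i j _ _ _ _ => by rw [guMat_one, Matrix.one_apply]⟩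
  mul_mem' := by
    rintro g h ⟨hg, hg'⟩ ⟨hh, hh'⟩
    refine ⟨hg.mul hh, fun i j hi hi' hj hj' => ?_⟩
    rw [GU.mul_apply, Finset.sum_eq_single i, hg' i i hi hi' hi hi', hh' i j hi hi' hj hj',
      if_pos rfl, one_mul]
    · intro k _ hk
      rcases lt_or_gt_of_ne hk with hlt | hgt
      · rw [hg hlt, zero_mul]
      · have : (i : ℕ) < k := hgt
        by_cases hk' : (k : ℕ) + a < n
        · rw [hg' i k hi hi' (by omega) hk', if_neg hk.symm, zero_mul]
        · rw [hh (show j < k by rw [Fin.lt_def]; omega), mul_zero]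
    · exact fun h => absurd (Finset.mem_univ _) h
  inv_mem' := by
    rintro g ⟨hg, hg'⟩
    refine ⟨fun i j hij => ?_, fun i j hi hi' hj hj' => ?_⟩
    · rw [GU.inv_apply, @hg j.rev i.rev (Fin.rev_lt_rev.2 hij), map_zero]
    · rw [GU.inv_apply, hg' _ _ (by rw [Fin.val_rev]; omega) (by rw [Fin.val_rev]; omega)
        (by rw [Fin.val_rev]; omega) (by rw [Fin.val_rev]; omega)]
      simp [eq_comm]

/-- Replace everything outside the middle block by the identity. -/
def midBlock (a : ℕ) (M : Matrix (Fin n) (Fin n) F) : Matrix (Fin n) (Fin n) F :=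
  Matrix.of fun i j =>
    if (a ≤ (i : ℕ) ∧ (i : ℕ) + a < n) ∧ (a ≤ (j : ℕ) ∧ (j : ℕ) + a < n) then M i j
    else if i = j then 1 else 0

lemma midBlock_apply_of_mid {a : ℕ} (M : Matrix (Fin n) (Fin n) F) {i j : Fin n}
    (hi : a ≤ (i : ℕ) ∧ (i : ℕ) + a < n) (hj : a ≤ (j : ℕ) ∧ (j : ℕ) + a < n) :
    midBlock a M i j = M i j := if_pos ⟨hi, hj⟩

lemma midBlock_apply_of_not_left {a : ℕ} (M : Matrix (Fin n) (Fin n) F) {i j : Fin n}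
    (hi : ¬ (a ≤ (i : ℕ) ∧ (i : ℕ) + a < n)) : midBlock a M i j = if i = j then 1 else 0 :=
  if_neg fun h => hi h.1

lemma midBlock_apply_of_not_right {a : ℕ} (M : Matrix (Fin n) (Fin n) F) {i j : Fin n}
    (hj : ¬ (a ≤ (j : ℕ) ∧ (j : ℕ) + a < n)) : midBlock a M i j = if i = j then 1 else 0 :=
  if_neg fun h => hj h.2

lemma midBlock_blockTriangular {a : ℕ} {M : Matrix (Fin n) (Fin n) F}
    (hM : M.BlockTriangular id) : (midBlock a M).BlockTriangular id := by
  intro i j hij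
  have hne : i ≠ j := (ne_of_lt hij).symm
  simp only [midBlock, Matrix.of_apply]
  split_ifs
  · exact hM hij
  · rfl

lemma sum_mul_midBlock {φ : F →+* F} {a : ℕ} {g : GU F φ n} (hg : (guMat g).BlockTriangular id)
    {i j : Fin n} (hi : a ≤ (i : ℕ) ∧ (i : ℕ) + a < n) (hj : a ≤ (j : ℕ) ∧ (j : ℕ) + a < n) :
    ∑ k, guMat g i k * φ (midBlock a (guMat g) j.rev k.rev) = if i = j then 1 else 0 := by
  have hjr : a ≤ (j.rev : ℕ) ∧ (j.rev : ℕ) + a < n := by rw [Fin.val_rev]; omega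
  rw [← GU.sum_mul_eq g i j]
  refine Finset.sum_congr rfl fun k _ => ?_
  by_cases hk : a ≤ (k : ℕ) ∧ (k : ℕ) + a < n
  · rw [midBlock_apply_of_mid _ hjr (by rw [Fin.val_rev]; omega)]
  · by_cases hk' : a ≤ (k : ℕ)
    · have hkr : ¬ (a ≤ (k.rev : ℕ) ∧ (k.rev : ℕ) + a < n) := by rw [Fin.val_rev]; omega
      rw [midBlock_apply_of_not_right _ hkr, if_neg (fun h : j.rev = k.rev => hkr (h ▸ hjr)),
        @hg j.rev k.rev (show k.rev < j.rev by rw [Fin.lt_def, Fin.val_rev, Fin.val_rev]; omega)]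
    · rw [hg (show k < i by rw [Fin.lt_def]; omega), zero_mul, zero_mul]

lemma midBlock_mul_twistStar {φ : F →+* F} (a : ℕ) {g : GU F φ n}
    (hg : (guMat g).BlockTriangular id) :
    midBlock a (guMat g) * twistStar φ (midBlock a (guMat g)) = 1 := by
  ext i j
  rw [Matrix.one_apply, Matrix.mul_apply]
  simp only [twistStar, Matrix.of_apply]
  by_cases hi : a ≤ (i : ℕ) ∧ (i : ℕ) + a < n
  · by_cases hj : a ≤ (j : ℕ) ∧ (j : ℕ) + a < n
    · rw [← sum_mul_midBlock hg hi hj]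
      refine Finset.sum_congr rfl fun k _ => ?_
      by_cases hk : a ≤ (k : ℕ) ∧ (k : ℕ) + a < n
      · rw [midBlock_apply_of_mid _ hi hk]
      · have hjr : a ≤ (j.rev : ℕ) ∧ (j.rev : ℕ) + a < n := by rw [Fin.val_rev]; omega
        have hkr : ¬ (a ≤ (k.rev : ℕ) ∧ (k.rev : ℕ) + a < n) := by rw [Fin.val_rev]; omega
        rw [midBlock_apply_of_not_right _ hkr, if_neg (fun h : j.rev = k.rev => hkr (h ▸ hjr)), map_zero,
          mul_zero, mul_zero]
    · have hjr : ¬ (a ≤ (j.rev : ℕ) ∧ (j.rev : ℕ) + a < n) := by rw [Fin.val_rev]; omega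
      simp only [midBlock_apply_of_not_left _ hjr, Fin.rev_inj]
      simp [midBlock_apply_of_not_right _ hj]
  · simp only [midBlock_apply_of_not_left _ hi]
    have hir : ¬ (a ≤ (i.rev : ℕ) ∧ (i.rev : ℕ) + a < n) := by rw [Fin.val_rev]; omega
    simp [midBlock_apply_of_not_right _ hir, eq_comm]

lemma Unr_le_midUnipotent (φ : F →+* F) (r : ℕ) : Unr F φ r 2 ≤ midUnipotent φ 2 (r + 2 * 2) := by
  rw [Unr, Subgroup.closure_le]
  rintro g ⟨k, hk, u, ⟨hu₁, hu₂, hu₃⟩, hg⟩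
  change ∀ i j, guMat g i j = _ at hg
  refine ⟨fun i j hij => ?_, fun i j hi hi' hj hj' => ?_⟩
  · have hij' : (j : ℕ) < i := hij
    rw [hg, cembFun]
    split_ifs with h
    · exact hu₁ _ _ (by simp only; omega)
    · omega
    · rfl
  · rw [hg, cembFun]
    simp only [Fin.ext_iff]
    split_ifs with h h' h'
    · simp only [h']
      exact hu₂ _ (by simp only; omega) (by simp only; omega)
    · rcases lt_or_gt_of_ne h' with hlt | hlt
      · exact hu₃ _ _ (by simp only; omega) (by simp only; omega) (by simp only; omega)
      · exact hu₁ _ _ (by simp only; omega)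
    · rfl
    · rfl

lemma midUnipotent_le_Unr (φ : F →+* F) (r : ℕ) : midUnipotent φ 2 (r + 2 * 2) ≤ Unr F φ r 2 := by
  rintro g ⟨hg, hg'⟩
  let h : GU F φ (r + 2 * 2) := GU.ofMatrix _ (midBlock_mul_twistStar 1 hg)
  have hmat : guMat h = midBlock 1 (guMat g) := rfl
  have htri : (guMat h).BlockTriangular id := midBlock_blockTriangular hg
  have htri' : (guMat (g * h⁻¹)).BlockTriangular id := by
    rw [guMat_mul]
    refine hg.mul fun i j hij => ?_
    rw [GU.inv_apply, @htri j.rev i.rev (Fin.rev_lt_rev.2 hij), map_zero]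
  have hmid {i j : Fin (r + 2 * 2)} (hi : 1 ≤ (i : ℕ)) (hi' : (i : ℕ) ≤ r + 2) (hj : 1 ≤ (j : ℕ))
      (hj' : (j : ℕ) ≤ r + 2) : guMat (g * h⁻¹) i j = if i = j then 1 else 0 := by
    rw [GU.mul_apply, ← sum_mul_midBlock (a := 1) hg (by omega) (by omega)]
    simp only [GU.inv_apply, hmat]
  rw [← inv_mul_cancel_right g h]
  refine mul_mem (Subgroup.subset_closure ?_) (Subgroup.subset_closure ?_)
  · refine ⟨1, one_lt_two, (guMat (g * h⁻¹)).submatrix (Fin.cast (by omega)) (Fin.cast (by omega)),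
      ⟨fun i j hij => htri' hij, fun i hi hi' => ?_, fun i j hi hij hj => ?_⟩, fun i j => ?_⟩
    · exact (hmid hi hi' hi hi').trans (if_pos rfl)
    · refine (hmid hi ?_ ?_ hj).trans (if_neg ?_)
      · exact hij.le.trans hj
      · exact hi.trans hij.le
      · exact fun h => hij.ne (Fin.ext_iff.1 h)
    · rw [cembFun, dif_pos (by omega)]
      rfl
  · refine ⟨0, zero_lt_two, Matrix.of fun i j =>
      guMat g ⟨i + 1, by omega⟩ ⟨j + 1, by omega⟩,
      ⟨fun i j hij => hg (Nat.succ_lt_succ hij), fun i hi hi' => ?_,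
        fun i j hi hij hj => ?_⟩, fun i j => ?_⟩
    · rw [Matrix.of_apply, hg' _ _ (by simp only; omega) (by simp only; omega)
        (by simp only; omega) (by simp only; omega), if_pos rfl]
    · rw [Matrix.of_apply, hg' _ _ (by simp only; omega) (by simp only; omega)
        (by simp only; omega) (by simp only; omega), if_neg (by simp only [Fin.mk.injEq]; omega)]
    · change midBlock 1 (guMat g) i j = _
      rw [cembFun]
      by_cases hm : (1 ≤ (i : ℕ) ∧ (i : ℕ) + 1 < r + 2 * 2) ∧ (1 ≤ (j : ℕ) ∧ (j : ℕ) + 1 < r + 2 * 2)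
      · rw [midBlock_apply_of_mid _ hm.1 hm.2, dif_pos (by omega), Matrix.of_apply]
        congr 1 <;> ext <;> simp only <;> omega
      · rw [dif_neg (by omega)]
        exact (if_neg hm).trans (by simp only [Fin.ext_iff])

lemma Unr_eq_midUnipotent (φ : F →+* F) (r : ℕ) : Unr F φ r 2 = midUnipotent φ 2 (r + 2 * 2) :=
  le_antisymm (Unr_le_midUnipotent φ r) (midUnipotent_le_Unr φ r)

end Parabolic

section Weyl

variable {F : Type*} [Field F] {n : ℕ}

lemma guMat_mul_permMat {φ : F →+* F} {s t : GU F φ n} {v w : Equiv.Perm (Fin n)}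
    (hs : guMat s = permMat F n v) (ht : guMat t = permMat F n w) :
    guMat (s * t) = permMat F n (w * v) := by
  ext i j
  rw [GU.mul_apply, hs, ht, Finset.sum_eq_single (v i)]
  · simp only [permMat, Matrix.of_apply, if_true, one_mul]
    rfl
  · intro k _ hk
    simp [permMat, hk.symm]
  · exact fun h => absurd (Finset.mem_univ _) h

lemma permMat_one : permMat F n 1 = 1 := by
  ext i j
  rw [Matrix.one_apply]
  rfl

lemma inv_eq_self_of_permMat {φ : F →+* F} {s : GU F φ n} {w : Equiv.Perm (Fin n)}
    (hs : guMat s = permMat F n w) (hw : w * w = 1) : s⁻¹ = s := by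
  rw [inv_eq_iff_mul_eq_one]
  apply guMat_injective
  rw [guMat_mul_permMat hs hs, hw, permMat_one, guMat_one]

variable {r : ℕ}

/-- The permutation `(1,2)(r+3,r+4)`, written with indices starting at `0`. -/
def doubleSwap (r : ℕ) : Equiv.Perm (Fin (r + 2 * 2)) :=
  Equiv.swap ⟨0, by omega⟩ ⟨1, by omega⟩ * Equiv.swap ⟨r + 2, by omega⟩ ⟨r + 3, by omega⟩

lemma doubleSwap_val (i : Fin (r + 2 * 2)) : (doubleSwap r i : ℕ) =
    if (i : ℕ) = 0 then 1 else if (i : ℕ) = 1 then 0 else if (i : ℕ) = r + 2 then r + 3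
      else if (i : ℕ) = r + 3 then r + 2 else i := by
  simp only [doubleSwap, Equiv.Perm.mul_apply, Equiv.swap_apply_def, Fin.ext_iff]
  grind

lemma doubleSwap_mul_self : doubleSwap r * doubleSwap r = 1 := by
  ext i
  rw [Equiv.Perm.mul_apply, doubleSwap_val, doubleSwap_val, Equiv.Perm.one_apply]
  grind

/-- The permutation `(2,r+3)`, written with indices starting at `0`. -/
def innerSwap (r : ℕ) : Equiv.Perm (Fin (r + 2 * 2)) :=
  Equiv.swap ⟨1, by omega⟩ ⟨r + 2, by omega⟩

lemma innerSwap_val (i : Fin (r + 2 * 2)) : (innerSwap r i : ℕ) =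
    if (i : ℕ) = 1 then r + 2 else if (i : ℕ) = r + 2 then 1 else i := by
  simp only [innerSwap, Equiv.swap_apply_def, Fin.ext_iff]
  grind

lemma doubleSwap_mul_innerSwap_mul_doubleSwap :
    doubleSwap r * (innerSwap r * doubleSwap r) = Equiv.swap ⟨0, by omega⟩ ⟨r + 3, by omega⟩ := by
  rw [← mul_assoc]
  nth_rewrite 2 [← inv_eq_of_mul_eq_one_left (doubleSwap_mul_self (r := r))]
  rw [innerSwap, ← Equiv.swap_apply_apply]
  congr 1
  ext
  rw [doubleSwap_val]
  simp

/-- The matrix `1 + t E₁₂ - φ(t) E_{r+3,r+4}`. -/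
def rootMat (φ : F →+* F) (r : ℕ) (t : F) : Matrix (Fin (r + 2 * 2)) (Fin (r + 2 * 2)) F :=
  Matrix.of fun i j => if i = j then 1 else if (i : ℕ) = 0 ∧ (j : ℕ) = 1 then t
    else if (i : ℕ) = r + 2 ∧ (j : ℕ) = r + 3 then -φ t else 0

lemma twistStar_rootMat {φ : F →+* F} (hφ : ∀ x, φ (φ x) = x) (t : F) :
    twistStar φ (rootMat φ r t) = rootMat φ r (-t) := by
  ext i j
  simp only [twistStar, rootMat, Matrix.of_apply, Fin.ext_iff, Fin.val_rev]
  split_ifs <;> first | omega | simp [hφ]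

lemma mul_rootMat_apply {φ : F →+* F} (M : Matrix (Fin (r + 2 * 2)) (Fin (r + 2 * 2)) F) (t : F)
    (i j : Fin (r + 2 * 2)) : (M * rootMat φ r t) i j =
      M i j + (if (j : ℕ) = 1 then M i ⟨0, by omega⟩ * t else 0)
        - (if (j : ℕ) = r + 3 then M i ⟨r + 2, by omega⟩ * φ t else 0) := by
  have h (k : Fin (r + 2 * 2)) : M i k * rootMat φ r t k j =
      (if k = j then M i j else 0)
        + (if k = ⟨0, by omega⟩ then (if (j : ℕ) = 1 then M i ⟨0, by omega⟩ * t else 0) else 0)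
        - (if k = ⟨r + 2, by omega⟩ then
            (if (j : ℕ) = r + 3 then M i ⟨r + 2, by omega⟩ * φ t else 0) else 0) := by
    simp only [rootMat, Matrix.of_apply]
    rcases eq_or_ne k j with rfl | hkj
    · grind
    · grind
  rw [Matrix.mul_apply, Finset.sum_congr rfl fun k _ => h k, Finset.sum_sub_distrib,
    Finset.sum_add_distrib, Finset.sum_ite_eq', Finset.sum_ite_eq', Finset.sum_ite_eq',
    if_pos (Finset.mem_univ _), if_pos (Finset.mem_univ _), if_pos (Finset.mem_univ _)]

lemma rootMat_mul_twistStar {φ : F →+* F} (hφ : ∀ x, φ (φ x) = x) (t : F) :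
    rootMat φ r t * twistStar φ (rootMat φ r t) = 1 := by
  rw [twistStar_rootMat hφ]
  ext i j
  rw [mul_rootMat_apply, Matrix.one_apply]
  simp only [rootMat, Matrix.of_apply, Fin.ext_iff, map_neg]
  grind

/-- The root element `1 + t E₁₂ - φ(t) E_{r+3,r+4}` of the unitary group. -/
def rootElt {φ : F →+* F} (hφ : ∀ x, φ (φ x) = x) (r : ℕ) (t : F) : GU F φ (r + 2 * 2) :=
  GU.ofMatrix (rootMat φ r t) (rootMat_mul_twistStar hφ t)

lemma rootElt_mem {φ : F →+* F} (hφ : ∀ x, φ (φ x) = x) (t : F) :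
    rootElt hφ r t ∈ midUnipotent φ 2 (r + 2 * 2) := by
  refine ⟨fun i j hij => ?_, fun i j hi hi' hj hj' => ?_⟩
  · have hij' : (j : ℕ) < i := hij
    simp only [rootElt, guMat_ofMatrix, rootMat, Matrix.of_apply, Fin.ext_iff]
    grind
  · simp only [rootElt, guMat_ofMatrix, rootMat, Matrix.of_apply, Fin.ext_iff]
    grind

variable {φ : F →+* F} {σ τ : GU F φ (r + 2 * 2)}

lemma conj_rootElt_mem (hφ : ∀ x, φ (φ x) = x) (hτ : guMat τ = permMat F _ (innerSwap r)) (t : F) :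
    τ * rootElt hφ r t * τ⁻¹ ∈ midUnipotent φ 2 (r + 2 * 2) := by
  refine ⟨fun i j hij => ?_, fun i j hi hi' hj hj' => ?_⟩
  · have hij' : (j : ℕ) < i := hij
    rw [GU.conj_apply hτ]
    simp only [rootElt, guMat_ofMatrix, rootMat, Matrix.of_apply, Fin.ext_iff, innerSwap_val]
    grind
  · rw [GU.conj_apply hτ]
    simp only [rootElt, guMat_ofMatrix, rootMat, Matrix.of_apply, Fin.ext_iff, innerSwap_val]
    grind

lemma conj_rootElt_apply (hφ : ∀ x, φ (φ x) = x) (hτ : guMat τ = permMat F _ (innerSwap r))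
    (t : F) : guMat (τ * rootElt hφ r t * τ⁻¹) ⟨0, by omega⟩ ⟨1, by omega⟩ = 0 := by
  rw [GU.conj_apply hτ]
  simp only [rootElt, guMat_ofMatrix, rootMat, Matrix.of_apply, Fin.ext_iff, innerSwap_val]
  grind

lemma apply_zero_zero_ne_zero {g : GU F φ (r + 2 * 2)}
    (hg : (guMat g).BlockTriangular id) : guMat g ⟨0, by omega⟩ ⟨0, by omega⟩ ≠ 0 := by
  have h : (guMat g).det ≠ 0 := ((Matrix.isUnit_iff_isUnit_det _).1 g.1.isUnit).ne_zero
  rw [Matrix.det_of_isUpperTriangular hg, Finset.prod_ne_zero_iff] at h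
  exact h _ (Finset.mem_univ _)

/-- Vanishing of the entry `(1,2)` forces that of the entry `(r+3,r+4)`. -/
lemma apply_eq_zero_of_apply_eq_zero {g : GU F φ (r + 2 * 2)}
    (hg : (guMat g).BlockTriangular id) (h : guMat g ⟨0, by omega⟩ ⟨1, by omega⟩ = 0) :
    guMat g ⟨r + 2, by omega⟩ ⟨r + 3, by omega⟩ = 0 := by
  have hsum := GU.sum_mul_eq g ⟨r + 2, by omega⟩ ⟨r + 3, by omega⟩
  have hrev : (⟨r + 3, by omega⟩ : Fin (r + 2 * 2)).rev = ⟨0, by omega⟩ := by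
    ext; rw [Fin.val_rev]; simp only; omega
  rw [if_neg (by simp), hrev, Finset.sum_eq_single ⟨r + 3, by omega⟩, hrev, mul_eq_zero,
    map_eq_zero] at hsum
  · exact hsum.resolve_right (apply_zero_zero_ne_zero hg)
  · intro k _ hk
    rw [Ne, Fin.ext_iff] at hk
    rcases lt_or_ge (k : ℕ) (r + 2) with hlt | hge
    · rw [@hg ⟨r + 2, by omega⟩ k hlt, zero_mul]
    · have : k.rev = ⟨1, by omega⟩ := by
        ext; rw [Fin.val_rev]; simp only at hk ⊢; omega
      rw [this, h, map_zero, mul_zero]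
  · exact fun h => absurd (Finset.mem_univ _) h

lemma conj_mem_of_apply_eq_zero (hσ : guMat σ = permMat F _ (doubleSwap r)) {g : GU F φ (r + 2 * 2)}
    (hg : g ∈ midUnipotent φ 2 (r + 2 * 2)) (h : guMat g ⟨0, by omega⟩ ⟨1, by omega⟩ = 0) :
    σ * g * σ⁻¹ ∈ midUnipotent φ 2 (r + 2 * 2) := by
  refine ⟨fun i j hij => ?_, fun i j hi hi' hj hj' => ?_⟩
  · have hij' : (j : ℕ) < i := hij
    rw [GU.conj_apply hσ]
    have hi := doubleSwap_val i
    have hj := doubleSwap_val j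
    by_cases hlt : (doubleSwap r j : ℕ) < doubleSwap r i
    · exact hg.1 hlt
    · have hcases : ((j : ℕ) = 0 ∧ (i : ℕ) = 1) ∨ ((j : ℕ) = r + 2 ∧ (i : ℕ) = r + 3) := by grind
      rcases hcases with ⟨hj', hi'⟩ | ⟨hj', hi'⟩
      · convert h using 2 <;> ext <;> simp [hi, hj, hi', hj']
      · convert apply_eq_zero_of_apply_eq_zero hg.1 h using 2 <;> ext <;> simp [hi, hj, hi', hj']
  · have hfix {k : Fin (r + 2 * 2)} (hk : 2 ≤ (k : ℕ)) (hk' : (k : ℕ) + 2 < r + 2 * 2) :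
        doubleSwap r k = k := by
      ext
      rw [doubleSwap_val]
      grind
    rw [GU.conj_apply hσ, hfix hi hi', hfix hj hj', hg.2 i j hi hi' hj hj']

lemma exists_eq_mul_rootElt (hφ : ∀ x, φ (φ x) = x) {u : GU F φ (r + 2 * 2)}
    (hu : u ∈ midUnipotent φ 2 (r + 2 * 2)) : ∃ a ∈ midUnipotent φ 2 (r + 2 * 2), ∃ t : F,
      guMat a ⟨0, by omega⟩ ⟨1, by omega⟩ = 0 ∧ u = a * rootElt hφ r t := by
  set t := guMat u ⟨0, by omega⟩ ⟨1, by omega⟩ / guMat u ⟨0, by omega⟩ ⟨0, by omega⟩ with ht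
  refine ⟨u * (rootElt hφ r t)⁻¹, mul_mem hu (inv_mem (rootElt_mem hφ t)), t, ?_,
    (inv_mul_cancel_right _ _).symm⟩
  rw [guMat_mul, guMat_inv, rootElt, guMat_ofMatrix, twistStar_rootMat hφ, mul_rootMat_apply,
    if_pos rfl, if_neg (by simp only; omega), sub_zero, mul_neg, ht,
    mul_div_cancel₀ _ (apply_zero_zero_ne_zero hu.1), add_neg_cancel]

end Weyl

theorem statement4
    {F : Type*} [Field F] [Fintype F] [DecidableEq F]
    {R : Type*} [CommRing R]
    (p k q : ℕ) (hp : Nat.Prime p) (hk : 0 < k) (hq : q = p ^ k)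
    (hcard : Fintype.card F = q ^ 2)
    (φ : F →+* F) (hφ : ∀ x : F, φ x = x ^ q)
    (hR : IsUnit ((q : R) * ((q : R) ^ 2 - 1)))
    (r : ℕ)
    (σ τ ρ : GU F φ (r + 2 * 2))
    (hσ : ((σ : GL (Fin (r + 2 * 2)) F) : Matrix (Fin (r + 2 * 2)) (Fin (r + 2 * 2)) F)
        = permMat F (r + 2 * 2)
            (Equiv.swap ⟨0, by omega⟩ ⟨1, by omega⟩ *
             Equiv.swap ⟨r + 2, by omega⟩ ⟨r + 3, by omega⟩))
    (hτ : ((τ : GL (Fin (r + 2 * 2)) F) : Matrix (Fin (r + 2 * 2)) (Fin (r + 2 * 2)) F)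
        = permMat F (r + 2 * 2) (Equiv.swap ⟨1, by omega⟩ ⟨r + 2, by omega⟩))
    (hρ : ((ρ : GL (Fin (r + 2 * 2)) F) : Matrix (Fin (r + 2 * 2)) (Fin (r + 2 * 2)) F)
        = permMat F (r + 2 * 2) (Equiv.swap ⟨0, by omega⟩ ⟨r + 3, by omega⟩)) :
    let e : MonoidAlgebra R ↥(GU F φ (r + 2 * 2)) := eSub R (Unr F φ r 2)
    let T : MonoidAlgebra R ↥(GU F φ (r + 2 * 2)) :=
      (q : R) ^ 2 • (e * MonoidAlgebra.of R ↥(GU F φ (r + 2 * 2)) σ * e)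
    let X : MonoidAlgebra R ↥(GU F φ (r + 2 * 2)) :=
      (-(q : R)) ^ r • (e * MonoidAlgebra.of R ↥(GU F φ (r + 2 * 2)) τ * e)
    let X' : MonoidAlgebra R ↥(GU F φ (r + 2 * 2)) :=
      (-(q : R)) ^ (r + 2) • (e * MonoidAlgebra.of R ↥(GU F φ (r + 2 * 2)) ρ * e)
    T * X * T = (q : R) ^ 2 • X' := by
  intro e T X X'
  have hφ' (x : F) : φ (φ x) = x := by
    rw [hφ, hφ, ← pow_mul, ← sq, ← hcard, FiniteField.pow_card]
  replace hσ : guMat σ = permMat F _ (doubleSwap r) := hσ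
  replace hτ : guMat τ = permMat F _ (innerSwap r) := hτ
  have hσσ : σ⁻¹ = σ := inv_eq_self_of_permMat hσ doubleSwap_mul_self
  have hττ : τ⁻¹ = τ := inv_eq_self_of_permMat hτ (Equiv.swap_mul_self _ _)
  have hστσ : σ * τ * σ = ρ := by
    apply guMat_injective
    rw [guMat_mul_permMat (guMat_mul_permMat hσ hτ) hσ, doubleSwap_mul_innerSwap_mul_doubleSwap]
    exact hρ.symm
  have hU : IsUnit (Nat.card (Unr F φ r 2) : R) :=
    isUnit_card_of_upperTriangular hp hk hq hcard hR fun g hg => (Unr_le_midUnipotent φ r hg).1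
  have key := eSub_braid (x := σ) (y := τ) hU
    (fun u hu => by
      rw [Unr_eq_midUnipotent] at hu ⊢
      obtain ⟨a, ha, t, ha0, rfl⟩ := exists_eq_mul_rootElt hφ' hu
      refine ⟨a, _, rfl, conj_mem_of_apply_eq_zero hσ ha ha0, ?_⟩
      have := conj_rootElt_mem hφ' hτ t
      rwa [hττ] at this ⊢)
    (fun u hu => by
      rw [Unr_eq_midUnipotent] at hu ⊢
      obtain ⟨a, ha, t, ha0, hat⟩ := exists_eq_mul_rootElt hφ' (inv_mem hu)
      refine ⟨(rootElt hφ' r t)⁻¹, a⁻¹, by rw [← mul_inv_rev, ← hat, inv_inv], ?_, ?_⟩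
      · convert inv_mem (conj_mem_of_apply_eq_zero hσ (conj_rootElt_mem hφ' hτ t)
          (conj_rootElt_apply hφ' hτ t)) using 1
        group
      · convert inv_mem (conj_mem_of_apply_eq_zero hσ ha ha0) using 1
        rw [hσσ]
        simp only [mul_inv_rev, hσσ, mul_assoc])
  rw [hστσ] at key
  simp only [T, X, X', smul_mul_assoc, mul_smul_comm, smul_smul]
  rw [key]
  congr 1
  ring
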